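/- Let (X, d_X) and (Y, d_Y) be metric spaces, μ a Borel probability measure on X, and T : X → X a measure-preserving map having superpolynomial decay of correlations with respect to Lipschitz observables. Let F : X → Y be Lipschitz, let x₀ ∈ X, and suppose the local dimension d_{F*μ}(F(x₀)) = lim_{r→0} log F*μ(B̄_r(F(x₀)))/log r exists. Define the observed hitting time τ_r^F(x, x₀) = min{k ∈ ℕ⁺ : F(T^k(x)) ∈ B̄_r(F(x₀))}. Then for μ-almost every x ∈ X, lim_{r→0} log τ_r^F(x, x₀) / (−log r) = d_{F*μ}(F(x₀)). -/

import Mathlib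

open Filter MeasureTheory Metric Set Topology ENNReal NNReal

/-- Hitting time of the set `S` for the orbit of `x` under `T`:
`τ(x,S) = min {n ∈ ℕ⁺ : Tⁿ x ∈ S}`, equal to `⊤` if the orbit never enters `S`. -/
noncomputable def hitTime {X : Type*} (T : X → X) (S : Set X) (x : X) : ℕ∞ :=
  sInf ((fun n : ℕ => (n : ℕ∞)) '' {n : ℕ | 0 < n ∧ T^[n] x ∈ S})

/-- Superpolynomial decay of correlations with respect to Lipschitz observables: there is
`Φ : ℕ → [0,∞)` with `n^α Φ(n) → 0` for every `α > 0` such that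
`|∫ φ∘Tⁿ ψ dμ − ∫φ dμ ∫ψ dμ| ≤ ‖φ‖ ‖ψ‖ Φ(n)` for all Lipschitz `φ, ψ : X → ℝ`, where `‖φ‖`
is the Lipschitz norm (the supremum norm plus the Lipschitz constant). -/
def SuperpolynomialDecayOfCorrelations {X : Type*} [MetricSpace X] [MeasurableSpace X]
    (μ : MeasureTheory.Measure X) (T : X → X) : Prop :=
  ∃ Φ : ℕ → ℝ, (∀ n, 0 ≤ Φ n) ∧
    (∀ α : ℝ, 0 < α → Tendsto (fun n : ℕ => (n : ℝ) ^ α * Φ n) atTop (𝓝 0)) ∧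
    ∀ (φ ψ : X → ℝ) (Kφ Kψ : ℝ≥0) (Cφ Cψ : ℝ),
      LipschitzWith Kφ φ → LipschitzWith Kψ ψ →
      (∀ x, |φ x| ≤ Cφ) → (∀ x, |ψ x| ≤ Cψ) → ∀ n : ℕ,
      |(∫ x, φ (T^[n] x) * ψ x ∂μ) - (∫ x, φ x ∂μ) * ∫ x, ψ x ∂μ|
        ≤ (Cφ + Kφ) * (Cψ + Kψ) * Φ n

lemma hitTime_le {X : Type*} {T : X → X} {S : Set X} {x : X} {n : ℕ} (hn : 0 < n)
    (h : T^[n] x ∈ S) : hitTime T S x ≤ n :=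
  sInf_le ⟨n, ⟨hn, h⟩, rfl⟩

lemma hitTime_anti {X : Type*} (T : X → X) {S S' : Set X} (h : S ⊆ S') (x : X) :
    hitTime T S' x ≤ hitTime T S x :=
  sInf_le_sInf (image_mono fun _ hn => ⟨hn.1, h hn.2⟩)

lemma exists_of_hitTime_lt {X : Type*} {T : X → X} {S : Set X} {x : X} {a : ℝ}
    (h : (hitTime T S x : ℝ≥0∞) < ENNReal.ofReal a) :
    ∃ n : ℕ, 0 < n ∧ (n : ℝ) < a ∧ T^[n] x ∈ S := by
  have hne : ((fun n : ℕ => (n : ℕ∞)) '' {n : ℕ | 0 < n ∧ T^[n] x ∈ S}).Nonempty := by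
    by_contra hemp
    rw [not_nonempty_iff_eq_empty] at hemp
    rw [hitTime, hemp] at h
    simp at h
  obtain ⟨n, ⟨hn, hnS⟩, hn'⟩ := csInf_mem hne
  refine ⟨n, hn, ?_, hnS⟩
  have : hitTime T S x = n := hn'.symm
  rw [this, ENat.toENNReal_coe] at h
  by_contra! ha
  exact absurd h (not_lt.2 ((ENNReal.ofReal_le_ofReal ha).trans_eq (ENNReal.ofReal_natCast n)))

/-- Borel–Cantelli with real-valued bounds that hold from some index on. -/
lemma ae_eventually_notMem_of_summable {X : Type*} [MeasurableSpace X] {μ : Measure X}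
    [IsFiniteMeasure μ] {s : ℕ → Set X} {b : ℕ → ℝ} (hb : Summable b)
    (h : ∀ᶠ k in atTop, μ.real (s k) ≤ b k) : ∀ᵐ x ∂μ, ∀ᶠ k in atTop, x ∉ s k := by
  apply ae_eventually_notMem
  have hs : Summable fun k => μ.real (s k) := by
    refine hb.of_norm_bounded_eventually_nat ?_
    filter_upwards [h] with k hk
    rwa [Real.norm_of_nonneg measureReal_nonneg]
  convert hs.tsum_ofReal_ne_top using 3 with k
  exact (ofReal_measureReal).symm

lemma integral_mul_iterate_le {X : Type*} [MeasurableSpace X] {μ : Measure X}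
    {U : X → X} (hU : MeasurePreserving U μ μ)
    {φ : X → ℝ} (hφ : Measurable φ) {c : ℝ}
    (hc : ∀ j : ℕ, 0 < j → ∫ x, φ (U^[j] x) * φ x ∂μ ≤ c) {i j : ℕ} (hij : i ≠ j) :
    ∫ x, φ (U^[i] x) * φ (U^[j] x) ∂μ ≤ c := by
  wlog hlt : j < i generalizing i j
  · simpa only [mul_comm] using this hij.symm (by omega)
  have hm : Measurable fun x => φ (U^[i - j] x) * φ x :=
    (hφ.comp (hU.iterate _).measurable).mul hφ
  have key := integral_map (μ := μ) (hU.iterate j).measurable.aemeasurable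
    hm.aestronglyMeasurable
  rw [(hU.iterate j).map_eq] at key
  refine le_trans (le_of_eq ?_) (hc (i - j) (by omega))
  rw [key]
  simp only [← Function.iterate_add_apply, Nat.sub_add_cancel hlt.le]

/-- Second moment bound for the probability that an observable vanishes along a finite orbit. -/
lemma measureReal_forall_eq_zero_le {X : Type*} [MeasurableSpace X] {μ : Measure X}
    [IsProbabilityMeasure μ] {U : X → X} (hU : MeasurePreserving U μ μ) {φ : X → ℝ}
    (hφ : Measurable φ) (h0 : ∀ x, 0 ≤ φ x) (h1 : ∀ x, φ x ≤ 1) (hm : 0 < ∫ x, φ x ∂μ)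
    {η : ℝ} (hη : 0 ≤ η)
    (hc : ∀ j : ℕ, 0 < j → ∫ x, φ (U^[j] x) * φ x ∂μ ≤ (∫ x, φ x ∂μ) ^ 2 + η)
    {N : ℕ} (hN : 0 < N) :
    μ.real {x | ∀ i < N, φ (U^[i + 1] x) = 0}
      ≤ 1 / (N * ∫ x, φ x ∂μ) + η / (∫ x, φ x ∂μ) ^ 2 := by
  set m := ∫ x, φ x ∂μ with hm_def
  have hN' : (0 : ℝ) < N := by exact_mod_cast hN
  let f : ℕ → X → ℝ := fun i x => φ (U^[i + 1] x)
  have hfm : ∀ i, Measurable (f i) := fun i => hφ.comp (hU.iterate _).measurable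
  have hf0 : ∀ i x, 0 ≤ f i x := fun i x => h0 _
  have hf1 : ∀ i x, f i x ≤ 1 := fun i x => h1 _
  have hfint : ∀ i, Integrable (f i) μ := fun i =>
    Integrable.of_bound (hfm i).aestronglyMeasurable 1
      (ae_of_all _ fun x => by rw [Real.norm_of_nonneg (hf0 i x)]; exact hf1 i x)
  have hffint : ∀ i j, Integrable (fun x => f i x * f j x) μ := fun i j =>
    Integrable.of_bound ((hfm i).mul (hfm j)).aestronglyMeasurable 1
      (ae_of_all _ fun x => by
        rw [Real.norm_of_nonneg (mul_nonneg (hf0 i x) (hf0 j x))]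
        exact mul_le_one₀ (hf1 i x) (hf0 j x) (hf1 j x))
  have hfmean : ∀ i, ∫ x, f i x ∂μ = m := by
    intro i
    have key := integral_map (μ := μ) (hU.iterate (i + 1)).measurable.aemeasurable
      hφ.aestronglyMeasurable
    rw [(hU.iterate (i + 1)).map_eq] at key
    exact key.symm
  let Z : X → ℝ := fun x => ∑ i ∈ Finset.range N, f i x
  have hZint : Integrable Z μ := integrable_finsetSum _ fun i _ => hfint i
  have hZmean : ∫ x, Z x ∂μ = N * m := by
    simp only [Z]
    rw [integral_finsetSum _ fun i _ => hfint i]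
    simp [hfmean]
  have hZsq : ∀ x, Z x ^ 2 = ∑ i ∈ Finset.range N, ∑ j ∈ Finset.range N, f i x * f j x := by
    intro x
    rw [sq, Finset.sum_mul_sum]
  have hZ2int : Integrable (fun x => Z x ^ 2) μ := by
    simp only [hZsq]
    exact integrable_finsetSum _ fun i _ => integrable_finsetSum _ fun j _ => hffint i j
  have hterm : ∀ i j, ∫ x, f i x * f j x ∂μ ≤ m ^ 2 + η + if i = j then m else 0 := by
    intro i j
    split_ifs with hij
    · subst hij
      calc ∫ x, f i x * f i x ∂μ ≤ ∫ x, f i x ∂μ :=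
            integral_mono (hffint i i) (hfint i) fun x =>
              mul_le_of_le_one_left (hf0 i x) (hf1 i x)
        _ = m := hfmean i
        _ ≤ m ^ 2 + η + m := by nlinarith [sq_nonneg m]
    · rw [add_zero]
      exact integral_mul_iterate_le hU hφ hc (by omega)
  have hZ2 : ∫ x, Z x ^ 2 ∂μ ≤ N ^ 2 * (m ^ 2 + η) + N * m := by
    simp only [hZsq]
    rw [integral_finsetSum _ fun i _ => integrable_finsetSum _ fun j _ => hffint i j]
    calc ∑ i ∈ Finset.range N, ∫ x, ∑ j ∈ Finset.range N, f i x * f j x ∂μ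
        = ∑ i ∈ Finset.range N, ∑ j ∈ Finset.range N, ∫ x, f i x * f j x ∂μ :=
          Finset.sum_congr rfl fun i _ => integral_finsetSum _ fun j _ => hffint i j
      _ ≤ ∑ i ∈ Finset.range N, ∑ j ∈ Finset.range N,
            (m ^ 2 + η + if i = j then m else 0) :=
          Finset.sum_le_sum fun i _ => Finset.sum_le_sum fun j _ => hterm i j
      _ = ∑ i ∈ Finset.range N, (N * (m ^ 2 + η) + m) := by
          refine Finset.sum_congr rfl fun i hi => ?_
          rw [Finset.sum_add_distrib, Finset.sum_ite_eq, if_pos hi, Finset.sum_const,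
            Finset.card_range, nsmul_eq_mul]
      _ = N ^ 2 * (m ^ 2 + η) + N * m := by
          rw [Finset.sum_const, Finset.card_range, nsmul_eq_mul]
          ring
  have hexp : (fun x => (Z x - N * m) ^ 2)
      = fun x => Z x ^ 2 - 2 * (N * m) * Z x + (N * m) ^ 2 := by
    funext x
    ring
  have hsubint : Integrable (fun x => Z x ^ 2 - 2 * (N * m) * Z x) μ :=
    hZ2int.sub (hZint.const_mul _)
  have hvint : Integrable (fun x => (Z x - N * m) ^ 2) μ := by
    rw [hexp]
    exact hsubint.add (integrable_const _)
  have hvar : ∫ x, (Z x - N * m) ^ 2 ∂μ ≤ N ^ 2 * η + N * m := by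
    rw [hexp, integral_add hsubint (integrable_const _),
      integral_sub hZ2int (hZint.const_mul _), integral_const_mul, hZmean]
    simp only [integral_const, probReal_univ, one_smul]
    linarith
  have hmarkov := mul_meas_ge_le_integral_of_nonneg
    (ae_of_all μ fun x => sq_nonneg (Z x - N * m)) hvint ((N * m) ^ 2)
  have hsub : {x | ∀ i < N, φ (U^[i + 1] x) = 0} ⊆ {x | (N * m) ^ 2 ≤ (Z x - N * m) ^ 2} := by
    intro x hx
    have hZ0 : Z x = 0 := Finset.sum_eq_zero fun i hi => hx i (Finset.mem_range.1 hi)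
    simp [hZ0]
  have hNm : 0 < (N * m) ^ 2 := by positivity
  have hle : (N * m) ^ 2 * μ.real {x | ∀ i < N, φ (U^[i + 1] x) = 0} ≤ N ^ 2 * η + N * m :=
    (mul_le_mul_of_nonneg_left (measureReal_mono hsub) hNm.le).trans (hmarkov.trans hvar)
  have heq : 1 / (N * m) + η / m ^ 2 = (N ^ 2 * η + N * m) / (N * m) ^ 2 := by
    field_simp
    ring
  rw [heq, le_div_iff₀ hNm]
  linarith

/-- A Lipschitz bump function on the source, adapted to the preimage of a ball. -/
lemma exists_lipschitz_bump {X Y : Type*} [PseudoMetricSpace X] [PseudoMetricSpace Y] {K : ℝ≥0}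
    {F : X → Y} (hF : LipschitzWith K F) (y : Y) {r : ℝ≥0} (hr : 0 < r) :
    ∃ φ : X → ℝ, LipschitzWith (K / r) φ ∧ (∀ x, 0 ≤ φ x) ∧ (∀ x, φ x ≤ 1) ∧
      (∀ x ∈ F ⁻¹' closedBall y r, φ x = 1) ∧
      ∀ x, φ x ≠ 0 → x ∈ F ⁻¹' closedBall y (2 * r) := by
  have hr' : (0 : ℝ) < r := hr
  refine ⟨fun x => max 0 (min 1 (2 - dist (F x) y / r)), ?_, fun x => le_max_left _ _,
    fun x => max_le zero_le_one (min_le_left _ _), fun x hx => ?_, fun x hx => ?_⟩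
  · have h : LipschitzWith (K / r) fun x => 2 - dist (F x) y / r := by
      refine LipschitzWith.of_dist_le_mul fun a b => ?_
      have h1 : |dist (F a) y - dist (F b) y| ≤ K * dist a b :=
        (abs_dist_sub_le _ _ _).trans (hF.dist_le_mul a b)
      rw [Real.dist_eq, show 2 - dist (F a) y / r - (2 - dist (F b) y / r)
        = -((dist (F a) y - dist (F b) y) / r) by ring, abs_neg, abs_div, abs_of_pos hr',
        NNReal.coe_div, div_mul_eq_mul_div]
      gcongr
    exact (h.const_min 1).const_max 0
  · have : dist (F x) y / r ≤ 1 := (div_le_one hr').2 hx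
    change max 0 (min 1 (2 - dist (F x) y / r)) = 1
    rw [min_eq_left (by linarith), max_eq_right zero_le_one]
  · by_contra hxn
    apply hx
    have : 2 < dist (F x) y / r := (lt_div_iff₀ hr').2 (not_le.1 hxn)
    exact max_eq_left ((min_le_right _ _).trans (by linarith))

/-- Bound for the probability of missing the preimage of a ball up to time `g * N`, in terms of
the decay of correlations along multiples of the gap `g`. -/
lemma measureReal_forall_notMem_le {X Y : Type*} [MetricSpace X] [MetricSpace Y]
    [MeasurableSpace X] [BorelSpace X] {μ : Measure X} [IsProbabilityMeasure μ]
    {T : X → X} (hT : MeasurePreserving T μ μ) {Φ : ℕ → ℝ}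
    (hΦ : ∀ (φ ψ : X → ℝ) (Kφ Kψ : ℝ≥0) (Cφ Cψ : ℝ),
      LipschitzWith Kφ φ → LipschitzWith Kψ ψ →
      (∀ x, |φ x| ≤ Cφ) → (∀ x, |ψ x| ≤ Cψ) → ∀ n : ℕ,
      |(∫ x, φ (T^[n] x) * ψ x ∂μ) - (∫ x, φ x ∂μ) * ∫ x, ψ x ∂μ|
        ≤ (Cφ + Kφ) * (Cψ + Kψ) * Φ n)
    {K : ℝ≥0} {F : X → Y} (hF : LipschitzWith K F) (y : Y) {r : ℝ≥0} (hr : 0 < r)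
    (hp : 0 < μ.real (F ⁻¹' closedBall y r)) {g N : ℕ} (hg : 0 < g) (hN : 0 < N) {B : ℝ}
    (hB0 : 0 ≤ B) (hB : ∀ j : ℕ, 0 < j → Φ (g * j) ≤ B) :
    μ.real {x | ∀ n : ℕ, 0 < n → n ≤ g * N → T^[n] x ∉ F ⁻¹' closedBall y (2 * r)}
      ≤ 1 / (N * μ.real (F ⁻¹' closedBall y r))
        + (1 + K / r) ^ 2 * B / μ.real (F ⁻¹' closedBall y r) ^ 2 := by
  obtain ⟨φ, hφL, h0, h1, hone, hsupp⟩ := exists_lipschitz_bump hF y hr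
  have hφm : Measurable φ := hφL.continuous.measurable
  have hφint : Integrable φ μ := Integrable.of_bound hφm.aestronglyMeasurable 1
    (ae_of_all _ fun x => by rw [Real.norm_of_nonneg (h0 x)]; exact h1 x)
  have hSm : MeasurableSet (F ⁻¹' closedBall y (r : ℝ)) :=
    (isClosed_closedBall.preimage hF.continuous).measurableSet
  set p := μ.real (F ⁻¹' closedBall y (r : ℝ)) with hp_def
  have hpm : p ≤ ∫ x, φ x ∂μ := by
    rw [hp_def, ← integral_indicator_one hSm]
    refine integral_mono ((integrable_const (1 : ℝ)).indicator hSm) hφint fun x => ?_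
    by_cases hx : x ∈ F ⁻¹' closedBall y (r : ℝ)
    · simp [indicator_of_mem hx, hone x hx]
    · simp [indicator_of_notMem hx, h0 x]
  have habs : ∀ x, |φ x| ≤ 1 := fun x => by rw [abs_of_nonneg (h0 x)]; exact h1 x
  have hη : 0 ≤ (1 + (K : ℝ) / r) ^ 2 * B := by positivity
  have hcov : ∀ j : ℕ, 0 < j →
      ∫ x, φ ((T^[g])^[j] x) * φ x ∂μ ≤ (∫ x, φ x ∂μ) ^ 2 + (1 + (K : ℝ) / r) ^ 2 * B := by
    intro j hj
    have h := (le_abs_self _).trans (hΦ φ φ _ _ 1 1 hφL hφL habs habs (g * j))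
    rw [NNReal.coe_div, ← sq, ← sq, Function.iterate_mul] at h
    have := mul_le_mul_of_nonneg_left (hB j hj) (sq_nonneg (1 + (K : ℝ) / r))
    linarith
  have key := measureReal_forall_eq_zero_le (hT.iterate g) hφm h0 h1 (hp.trans_le hpm) hη hcov hN
  refine (measureReal_mono ?_).trans (key.trans ?_)
  · intro x hx i hi
    by_contra hne
    refine hx (g * (i + 1)) (by positivity) (by gcongr; omega) (hsupp _ ?_)
    rwa [Function.iterate_mul]
  · gcongr

lemma ceil_exp_le {t : ℝ} (ht : 0 ≤ t) : (⌈Real.exp t⌉₊ : ℝ) ≤ 2 * Real.exp t := by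
  have h1 := Nat.ceil_lt_add_one (Real.exp_nonneg t)
  have h2 := Real.one_le_exp ht
  linarith

lemma summable_const_mul_exp_neg_mul (C : ℝ) {c : ℝ} (hc : 0 < c) :
    Summable fun k : ℕ => C * Real.exp (-(c * k)) := by
  refine Summable.mul_left C ?_
  have := Real.summable_exp_nat_mul_iff.2 (neg_lt_zero.2 hc)
  refine this.congr fun k => ?_
  congr 1
  ring

lemma exists_le_mul_rpow_neg {Φ : ℕ → ℝ}
    (h : ∀ α : ℝ, 0 < α → Tendsto (fun n : ℕ => (n : ℝ) ^ α * Φ n) atTop (𝓝 0))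
    {α : ℝ} (hα : 0 < α) : ∃ A : ℝ, 0 ≤ A ∧ ∀ n : ℕ, 0 < n → Φ n ≤ A * (n : ℝ) ^ (-α) := by
  obtain ⟨A, hA⟩ := (h α hα).bddAbove_range
  refine ⟨max A 0, le_max_right _ _, fun n hn => ?_⟩
  have hn' : (0 : ℝ) < n := by exact_mod_cast hn
  have h1 : (n : ℝ) ^ α * Φ n ≤ A := hA ⟨n, rfl⟩
  rw [Real.rpow_neg hn'.le, ← div_eq_mul_inv, le_div_iff₀ (Real.rpow_pos_of_pos hn' α), mul_comm]
  exact h1.trans (le_max_left _ _)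

/-- Upper bound for hitting times along the scales `exp (-k)`. -/
lemma ae_eventually_hitTime_le {X Y : Type*} [MetricSpace X] [MetricSpace Y]
    [MeasurableSpace X] [BorelSpace X] {μ : Measure X} [IsProbabilityMeasure μ]
    {T : X → X} (hT : MeasurePreserving T μ μ) (hmix : SuperpolynomialDecayOfCorrelations μ T)
    {K : ℝ≥0} {F : X → Y} (hF : LipschitzWith K F) (y : Y) {D δ : ℝ} (hδ : 0 < δ)
    (hD : ∀ᶠ k : ℕ in atTop,
      Real.exp (-(D * k)) ≤ μ.real (F ⁻¹' closedBall y (Real.exp (-k)))) :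
    ∀ᵐ x ∂μ, ∀ᶠ k : ℕ in atTop,
      (hitTime T (F ⁻¹' closedBall y (Real.exp (-k))) x : ℝ≥0∞)
        ≤ ENNReal.ofReal (4 * Real.exp ((D + 2 * δ) * k)) := by
  obtain ⟨Φ, hΦ0, hΦlim, hΦ⟩ := hmix
  have hD0 : 0 ≤ D := by
    obtain ⟨k, hk, hk1⟩ := (hD.and (eventually_ge_atTop 1)).exists
    have h1 : Real.exp (-(D * k)) ≤ 1 := hk.trans measureReal_le_one
    have h2 : -(D * k) ≤ 0 := Real.exp_le_one_iff.1 h1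
    have hk' : (0 : ℝ) < k := by exact_mod_cast hk1
    by_contra! hneg
    nlinarith
  set α : ℝ := (3 + 2 * D) / δ with hα_def
  have hα : 0 < α := by positivity
  have hαδ : δ * α = 3 + 2 * D := by rw [hα_def]; field_simp
  obtain ⟨A, hA0, hA⟩ := exists_le_mul_rpow_neg hΦlim hα
  let g : ℕ → ℕ := fun k => ⌈Real.exp (δ * k)⌉₊
  let N : ℕ → ℕ := fun k => ⌈Real.exp ((D + δ) * k)⌉₊
  have hg : ∀ k, 0 < g k := fun k => Nat.ceil_pos.2 (Real.exp_pos _)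
  have hN : ∀ k, 0 < N k := fun k => Nat.ceil_pos.2 (Real.exp_pos _)
  have hbad : ∀ᶠ k : ℕ in atTop,
      μ.real {x | ∀ n : ℕ, 0 < n → n ≤ g k * N k →
        T^[n] x ∉ F ⁻¹' closedBall y (Real.exp (-k))}
      ≤ Real.exp D * Real.exp (-(δ * k))
        + (1 + K) ^ 2 * A * Real.exp (2 + 2 * D) * Real.exp (-(1 * k)) := by
    filter_upwards [(tendsto_add_atTop_nat 1).eventually hD] with k hk
    let r : ℝ≥0 := ⟨Real.exp (-((k + 1 : ℕ) : ℝ)), (Real.exp_pos _).le⟩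
    have hr' : (r : ℝ) = Real.exp (-((k + 1 : ℕ) : ℝ)) := rfl
    have hr : 0 < r := Real.exp_pos _
    have hrle : (2 * r : ℝ) ≤ Real.exp (-k) := by
      rw [hr', Nat.cast_add, Nat.cast_one, neg_add, Real.exp_add, Real.exp_neg 1]
      have h2 : (2 : ℝ) ≤ Real.exp 1 := by linarith [Real.add_one_le_exp 1]
      have h3 : 2 * (Real.exp 1)⁻¹ ≤ 1 := by
        rw [← div_eq_mul_inv]; exact (div_le_one (Real.exp_pos 1)).2 h2
      nlinarith [Real.exp_pos (-(k : ℝ))]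
    rw [← hr'] at hk
    set p := μ.real (F ⁻¹' closedBall y (r : ℝ)) with hp_def
    have hp : 0 < p := (Real.exp_pos _).trans_le hk
    have hB0 : 0 ≤ A * Real.exp (-(δ * α * k)) := by positivity
    have hB : ∀ j : ℕ, 0 < j → Φ (g k * j) ≤ A * Real.exp (-(δ * α * k)) := by
      intro j hj
      refine (hA _ (Nat.mul_pos (hg k) hj)).trans (mul_le_mul_of_nonneg_left ?_ hA0)
      have hle : Real.exp (δ * k) ≤ ((g k * j : ℕ) : ℝ) :=
        (Nat.le_ceil _).trans (by exact_mod_cast Nat.le_mul_of_pos_right (g k) hj)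
      refine (Real.rpow_le_rpow_of_nonpos (Real.exp_pos _) hle (neg_nonpos.2 hα.le)).trans_eq ?_
      rw [← Real.exp_mul]
      congr 1
      ring
    have key := measureReal_forall_notMem_le hT hΦ hF y hr hp (hg k) (hN k) hB0 hB
    refine (measureReal_mono ?_).trans (key.trans (add_le_add ?_ ?_))
    · intro x hx n hn hnN hmem
      exact hx n hn hnN (preimage_mono (closedBall_subset_closedBall hrle) hmem)
    · calc 1 / (N k * p)
          ≤ 1 / (Real.exp ((D + δ) * k) * Real.exp (-(D * (k + 1 : ℕ)))) := by
            gcongr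
            exact Nat.le_ceil _
        _ = Real.exp D * Real.exp (-(δ * k)) := by
            rw [← Real.exp_add, one_div, ← Real.exp_neg, ← Real.exp_add]
            congr 1
            push_cast
            ring
    · have hKr : 1 + (K : ℝ) / r ≤ (1 + K) * Real.exp (k + 1) := by
        have h1 : (1 : ℝ) ≤ Real.exp (k + 1) := Real.one_le_exp (by positivity)
        rw [hr', Real.exp_neg, div_inv_eq_mul]
        push_cast
        linarith
      calc (1 + (K : ℝ) / r) ^ 2 * (A * Real.exp (-(δ * α * k))) / p ^ 2
          ≤ ((1 + K) * Real.exp (k + 1)) ^ 2 * (A * Real.exp (-(δ * α * k)))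
              / Real.exp (-(D * (k + 1 : ℕ))) ^ 2 := by
            gcongr
        _ = (1 + K) ^ 2 * A * (Real.exp (k + 1) ^ 2 * Real.exp (-(δ * α * k))
              * (Real.exp (-(D * (k + 1 : ℕ))) ^ 2)⁻¹) := by ring
        _ = (1 + K) ^ 2 * A * (Real.exp (2 + 2 * D) * Real.exp (-(1 * k))) := by
            rw [← Real.exp_nat_mul, ← Real.exp_nat_mul, ← Real.exp_neg, ← Real.exp_add,
              ← Real.exp_add, ← Real.exp_add, hαδ]
            congr 2
            push_cast
            ring
        _ = _ := by ring
  filter_upwards [ae_eventually_notMem_of_summable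
    ((summable_const_mul_exp_neg_mul _ hδ).add (summable_const_mul_exp_neg_mul _ one_pos)) hbad]
    with x hx
  filter_upwards [hx] with k hk
  simp only [not_forall, not_not] at hk
  obtain ⟨n, hn, hnN, hmem⟩ := hk
  calc (hitTime T (F ⁻¹' closedBall y (Real.exp (-k))) x : ℝ≥0∞)
      ≤ ((n : ℕ∞) : ℝ≥0∞) := ENat.toENNReal_le.2 (hitTime_le hn hmem)
    _ = ENNReal.ofReal n := by rw [ENat.toENNReal_coe, ENNReal.ofReal_natCast]
    _ ≤ ENNReal.ofReal (4 * Real.exp ((D + 2 * δ) * k)) := by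
        refine ENNReal.ofReal_le_ofReal ?_
        calc (n : ℝ) ≤ g k * N k := by exact_mod_cast hnN
          _ ≤ (2 * Real.exp (δ * k)) * (2 * Real.exp ((D + δ) * k)) := by
              gcongr <;> exact ceil_exp_le (by positivity)
          _ = 4 * (Real.exp (δ * k) * Real.exp ((D + δ) * k)) := by ring
          _ = 4 * Real.exp ((D + 2 * δ) * k) := by
              rw [← Real.exp_add]
              ring_nf

/-- Lower bound for hitting times along a sequence of shrinking targets. -/
lemma ae_eventually_le_hitTime {X : Type*} [MeasurableSpace X] {μ : Measure X}
    [IsProbabilityMeasure μ] {T : X → X} (hT : MeasurePreserving T μ μ) {S : ℕ → Set X}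
    (hS : ∀ k, MeasurableSet (S k)) {D δ : ℝ} (hδ : 0 < δ)
    (hD : ∀ᶠ k : ℕ in atTop, μ.real (S k) ≤ Real.exp (-(D * k))) :
    ∀ᵐ x ∂μ, ∀ᶠ k : ℕ in atTop,
      ENNReal.ofReal (Real.exp ((D - δ) * k)) ≤ (hitTime T (S k) x : ℝ≥0∞) := by
  have hbad : ∀ᶠ k : ℕ in atTop,
      μ.real {x | (hitTime T (S k) x : ℝ≥0∞) < ENNReal.ofReal (Real.exp ((D - δ) * k))}
        ≤ 1 * Real.exp (-(δ * k)) := by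
    filter_upwards [hD] with k hk
    set M := Real.exp ((D - δ) * k) with hM
    have hsub : {x | (hitTime T (S k) x : ℝ≥0∞) < ENNReal.ofReal M}
        ⊆ ⋃ n ∈ Finset.Icc 1 ⌊M⌋₊, T^[n] ⁻¹' S k := by
      intro x hx
      obtain ⟨n, hn, hnM, hmem⟩ := exists_of_hitTime_lt hx
      simp only [mem_iUnion, Finset.mem_Icc]
      exact ⟨n, ⟨hn, Nat.le_floor hnM.le⟩, hmem⟩
    calc μ.real {x | (hitTime T (S k) x : ℝ≥0∞) < ENNReal.ofReal M}
        ≤ μ.real (⋃ n ∈ Finset.Icc 1 ⌊M⌋₊, T^[n] ⁻¹' S k) :=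
          measureReal_mono hsub (measure_ne_top _ _)
      _ ≤ ∑ n ∈ Finset.Icc 1 ⌊M⌋₊, μ.real (T^[n] ⁻¹' S k) := measureReal_biUnion_finset_le _ _
      _ = ⌊M⌋₊ * μ.real (S k) := by
          rw [Finset.sum_congr rfl fun n _ =>
            (hT.iterate n).measureReal_preimage (hS k).nullMeasurableSet]
          simp
      _ ≤ M * Real.exp (-(D * k)) := by
          gcongr
          exact Nat.floor_le (Real.exp_nonneg _)
      _ = 1 * Real.exp (-(δ * k)) := by
          rw [hM, ← Real.exp_add, one_mul]
          ring_nf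
  filter_upwards [ae_eventually_notMem_of_summable (summable_const_mul_exp_neg_mul _ hδ) hbad]
    with x hx
  filter_upwards [hx] with k hk
  exact not_lt.1 hk

lemma tendsto_exp_neg_natCast_nhdsGT_zero :
    Tendsto (fun k : ℕ => Real.exp (-k)) atTop (𝓝[>] 0) := by
  refine tendsto_nhdsWithin_iff.2 ⟨?_, Eventually.of_forall fun k => Real.exp_pos _⟩
  exact Real.tendsto_exp_neg_atTop_nhds_zero.comp tendsto_natCast_atTop_atTop

/-- Exponential bounds along `exp (-k)` from the logarithmic density of a set function. -/
lemma eventually_exp_le_toReal_le_exp {ν : ℝ → ℝ≥0∞} (hν : ∀ r, ν r ≠ ∞) {d : ℝ}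
    (hd : Tendsto (fun r : ℝ => ENNReal.log (ν r) / ((Real.log r : ℝ) : EReal))
      (𝓝[>] 0) (𝓝 (d : EReal))) {ε : ℝ} (hε : 0 < ε) :
    ∀ᶠ k : ℕ in atTop, Real.exp (-((d + ε) * k)) ≤ (ν (Real.exp (-k))).toReal ∧
      (ν (Real.exp (-k))).toReal ≤ Real.exp (-((d - ε) * k)) := by
  have hd' := hd.comp tendsto_exp_neg_natCast_nhdsGT_zero
  have h1 := hd'.eventually_lt_const
    (EReal.coe_lt_coe_iff.2 (by linarith : d < d + ε))
  have h2 := hd'.eventually_const_lt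
    (EReal.coe_lt_coe_iff.2 (by linarith : d - ε < d))
  filter_upwards [h1, h2, eventually_ge_atTop 1] with k hk1 hk2 hk
  have hk' : (0 : ℝ) < k := by exact_mod_cast hk
  simp only [Function.comp_apply, Real.log_exp] at hk1 hk2
  have hneg : ((-(k : ℝ) : ℝ) : EReal) ≤ 0 := by
    exact_mod_cast (neg_nonpos.2 hk'.le)
  have hcancel : ∀ c : ℝ, ((-(c * k) : ℝ) : EReal) / ((-(k : ℝ) : ℝ) : EReal) = c := by
    intro c
    rw [← EReal.coe_div]
    congr 1
    field_simp
  have hlog : ∀ c : ℝ, ENNReal.log (ENNReal.ofReal (Real.exp c)) = c := fun c => by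
    rw [ENNReal.log_ofReal_of_pos (Real.exp_pos c), Real.log_exp]
  constructor
  · rw [← ENNReal.ofReal_le_iff_le_toReal (hν _), ← ENNReal.log_le_log_iff, hlog]
    by_contra! hcon
    have := EReal.div_le_div_right_of_nonpos hneg hcon.le
    rw [hcancel] at this
    exact absurd hk1 (not_lt.2 this)
  · refine ENNReal.toReal_le_of_le_ofReal (Real.exp_nonneg _) ?_
    rw [← ENNReal.log_le_log_iff, hlog]
    by_contra! hcon
    have := EReal.div_le_div_right_of_nonpos hneg hcon.le
    rw [hcancel] at this
    exact absurd hk2 (not_lt.2 this)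

/-- An antitone function with exponential bounds along the scales `exp (-k)` has the
corresponding logarithmic growth rate at `0`. -/
lemma tendsto_log_div_neg_log {τ : ℝ → ℝ≥0∞} (hτ : Antitone τ) {d : ℝ}
    (h : ∀ ε > 0, ∃ C > 0, ∀ᶠ k : ℕ in atTop,
      ENNReal.ofReal (Real.exp ((d - ε) * k)) ≤ τ (Real.exp (-k)) ∧
      τ (Real.exp (-k)) ≤ ENNReal.ofReal (C * Real.exp ((d + ε) * k))) :
    Tendsto (fun r : ℝ => ENNReal.log (τ r) / ((-Real.log r : ℝ) : EReal))
      (𝓝[>] 0) (𝓝 (d : EReal)) := by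
  have hL : Tendsto (fun r : ℝ => -Real.log r) (𝓝[>] 0) atTop :=
    tendsto_neg_atBot_atTop.comp Real.tendsto_log_nhdsGT_zero
  have hfl : Tendsto (fun r : ℝ => ⌊-Real.log r⌋₊) (𝓝[>] 0) atTop :=
    tendsto_nat_floor_atTop.comp hL
  have hpos : ∀ᶠ r : ℝ in 𝓝[>] 0, 0 < r := self_mem_nhdsWithin
  refine tendsto_order.2 ⟨fun a ha => ?_, fun a ha => ?_⟩
  · obtain ⟨b, hab, hbd⟩ := EReal.lt_iff_exists_real_btwn.1 ha
    have hbd' : b < d := EReal.coe_lt_coe_iff.1 hbd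
    obtain ⟨C, -, hk⟩ := h ((d - b) / 2) (by linarith)
    have hlarge := hL.eventually_ge_atTop (2 * |(d + b) / 2| / (d - b))
    filter_upwards [hfl.eventually hk, hpos, hL.eventually_ge_atTop 1, hlarge]
      with r hr hr0 hr1 hrl
    refine hab.trans_le ?_
    set L := -Real.log r with hL_def
    have hL0 : 0 < L := by linarith
    have hfloor : (⌊L⌋₊ : ℝ) ≤ L := Nat.floor_le hL0.le
    have hfloor' : L < ⌊L⌋₊ + 1 := Nat.lt_floor_add_one L
    have hrexp : r = Real.exp (-L) := by rw [hL_def, neg_neg, Real.exp_log hr0]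
    rw [EReal.le_div_iff_mul_le (by exact_mod_cast hL0) (EReal.coe_ne_top _), ← EReal.coe_mul]
    have hmono : τ (Real.exp (-(⌊L⌋₊ : ℝ))) ≤ τ r := hτ (by rw [hrexp]; gcongr)
    have h1 := ENNReal.log_le_log (hr.1.trans hmono)
    rw [ENNReal.log_ofReal_of_pos (Real.exp_pos _), Real.log_exp] at h1
    refine le_trans (EReal.coe_le_coe_iff.2 ?_) h1
    rw [div_le_iff₀ (by linarith)] at hrl
    have h2 : |(d + b) / 2 * (L - ⌊L⌋₊)| ≤ |(d + b) / 2| * 1 := by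
      rw [abs_mul]
      gcongr
      rw [abs_le]
      constructor <;> linarith
    have h3 := (abs_le.1 h2).2
    nlinarith
  · obtain ⟨b, hdb, hba⟩ := EReal.lt_iff_exists_real_btwn.1 ha
    have hdb' : d < b := EReal.coe_lt_coe_iff.1 hdb
    obtain ⟨C, hC, hk⟩ := h ((b - d) / 2) (by linarith)
    have hlarge := hL.eventually_ge_atTop (2 * (|(d + b) / 2| + |Real.log C|) / (b - d))
    filter_upwards [((tendsto_add_atTop_nat 1).comp hfl).eventually hk, hpos,
      hL.eventually_ge_atTop 1, hlarge] with r hr hr0 hr1 hrl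
    refine lt_of_le_of_lt ?_ hba
    simp only [Function.comp_apply] at hr
    set L := -Real.log r with hL_def
    have hL0 : 0 < L := by linarith
    have hfloor : (⌊L⌋₊ : ℝ) ≤ L := Nat.floor_le hL0.le
    have hfloor' : L < ⌊L⌋₊ + 1 := Nat.lt_floor_add_one L
    have hrexp : r = Real.exp (-L) := by rw [hL_def, neg_neg, Real.exp_log hr0]
    rw [EReal.div_le_iff_le_mul (by exact_mod_cast hL0) (EReal.coe_ne_top _), ← EReal.coe_mul]
    have hmono : τ r ≤ τ (Real.exp (-((⌊L⌋₊ + 1 : ℕ) : ℝ))) :=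
      hτ (by rw [hrexp]; push_cast; gcongr)
    have h1 := ENNReal.log_le_log (hmono.trans hr.2)
    rw [ENNReal.log_ofReal_of_pos (by positivity), Real.log_mul hC.ne' (Real.exp_pos _).ne',
      Real.log_exp] at h1
    refine h1.trans (EReal.coe_le_coe_iff.2 ?_)
    rw [div_le_iff₀ (by linarith)] at hrl
    have h2 : |(d + b) / 2 * (⌊L⌋₊ + 1 - L)| ≤ |(d + b) / 2| * 1 := by
      rw [abs_mul]
      gcongr
      rw [abs_le]
      constructor <;> linarith
    have h3 := (abs_le.1 h2).2
    have h4 := le_abs_self (Real.log C)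
    push_cast
    nlinarith

/-- Logarithm law for observed systems: if the system has superpolynomial decay of
correlations with respect to Lipschitz observables, `F : X → Y` is Lipschitz, and the local
dimension `d = d_{F⋆μ}(F x₀) = lim_{r→0} log (F⋆μ)(B̄_r(F x₀))/log r` exists, then for
`μ`-a.e. `x`, `lim_{r→0} log τ_r^F(x,x₀)/(-log r) = d`, where
`τ_r^F(x,x₀) = min {k ∈ ℕ⁺ : F(Tᵏ x) ∈ B̄_r(F x₀)}`. -/
theorem logarithm_law_for_observed_systems
    {X Y : Type*} [MetricSpace X] [MetricSpace Y]
    [MeasurableSpace X] [BorelSpace X] [MeasurableSpace Y] [BorelSpace Y]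
    (μ : Measure X) [IsProbabilityMeasure μ]
    (T : X → X) (hT : MeasurePreserving T μ μ)
    (hmix : SuperpolynomialDecayOfCorrelations μ T)
    (K : ℝ≥0) (F : X → Y) (hF : LipschitzWith K F) (x₀ : X)
    (d : ℝ)
    (hd : Tendsto (fun r : ℝ =>
        ENNReal.log ((μ.map F) (closedBall (F x₀) r)) / ((Real.log r : ℝ) : EReal))
      (𝓝[>] 0) (𝓝 (d : EReal))) :
    ∀ᵐ x ∂μ,
      Tendsto (fun r : ℝ =>
          ENNReal.log ((hitTime T (F ⁻¹' closedBall (F x₀) r) x : ℝ≥0∞))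
            / ((- Real.log r : ℝ) : EReal))
        (𝓝[>] 0) (𝓝 (d : EReal)) := by
  have hFm : Measurable F := hF.continuous.measurable
  have hmap : ∀ r, (μ.map F (closedBall (F x₀) r)).toReal
      = μ.real (F ⁻¹' closedBall (F x₀) r) := fun r => by
    rw [Measure.map_apply hFm measurableSet_closedBall, measureReal_def]
  have := Measure.isProbabilityMeasure_map (μ := μ) hFm.aemeasurable
  have hdim := fun {ε : ℝ} (hε : 0 < ε) =>
    eventually_exp_le_toReal_le_exp (fun r => measure_ne_top (μ.map F) _) hd hε
  simp only [hmap] at hdim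
  have hae : ∀ j : ℕ, ∀ᵐ x ∂μ, ∀ᶠ k : ℕ in atTop,
      ENNReal.ofReal (Real.exp ((d - 1 / ((j : ℝ) + 1)) * k))
        ≤ hitTime T (F ⁻¹' closedBall (F x₀) (Real.exp (-k))) x ∧
      (hitTime T (F ⁻¹' closedBall (F x₀) (Real.exp (-k))) x : ℝ≥0∞)
        ≤ ENNReal.ofReal (4 * Real.exp ((d + 1 / ((j : ℝ) + 1)) * k)) := by
    intro j
    set δ : ℝ := 1 / ((j : ℝ) + 1) / 3 with hδ_def
    have hδ : 0 < δ := by positivity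
    have h3δ : 1 / ((j : ℝ) + 1) = 3 * δ := by rw [hδ_def]; ring
    have hup := ae_eventually_hitTime_le hT hmix hF (F x₀) hδ ((hdim hδ).mono fun k hk => hk.1)
    have hlow := ae_eventually_le_hitTime hT
      (S := fun k : ℕ => F ⁻¹' closedBall (F x₀) (Real.exp (-k)))
      (fun k => hFm measurableSet_closedBall) (by linarith : 0 < 2 * δ)
      ((hdim hδ).mono fun k hk => hk.2)
    filter_upwards [hup, hlow] with x hx1 hx2
    filter_upwards [hx1, hx2] with k hk1 hk2
    rw [h3δ]
    refine ⟨?_, ?_⟩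
    · rwa [show d - 3 * δ = d - δ - 2 * δ by ring]
    · rwa [show d + 3 * δ = d + δ + 2 * δ by ring]
  filter_upwards [ae_all_iff.2 hae] with x hx
  refine tendsto_log_div_neg_log (fun r s hrs => ENat.toENNReal_le.2
    (hitTime_anti T (preimage_mono (closedBall_subset_closedBall hrs)) x)) fun ε hε => ?_
  obtain ⟨j, hj⟩ := exists_nat_one_div_lt hε
  refine ⟨4, by norm_num, ?_⟩
  filter_upwards [hx j] with k hk
  refine ⟨le_trans (ENNReal.ofReal_le_ofReal ?_) hk.1,
    hk.2.trans (ENNReal.ofReal_le_ofReal ?_)⟩ <;> gcongr
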